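/- arXiv:1512.01663 — 4 statements merged into one kernel-verified Lean document; each statement's English description precedes it below -/
import Mathlib

section
/- Let n ≥ 2, let U, V ∈ ℂⁿ and λ ∈ ℂ with U ≠ 0. If U ⊗ V̄ − V ⊗ Ū = λ·I, i.e. U_α · conj(V_β) − V_α · conj(U_β) = λ·δ_{αβ} for all 1 ≤ α, β ≤ n, then there exists η ∈ ℂ such that V = η • U (that is, V_α = η·U_α for every α). -/
/-- Let `n ≥ 2`, `U, V ∈ ℂⁿ`, `λ ∈ ℂ` with `U ≠ 0`. If
`U ⊗ V̄ − V ⊗ Ū = λ·I`, then `V` is a complex scalar multiple of `U`. -/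
theorem proportional_of_skew_hermitian_identity (n : ℕ) (hn : 2 ≤ n)
    (U V : Fin n → ℂ) (lam : ℂ) (hU : U ≠ 0)
    (h : Matrix.vecMulVec U (star V) - Matrix.vecMulVec V (star U)
        = lam • (1 : Matrix (Fin n) (Fin n) ℂ)) :
    ∃ η : ℂ, V = η • U := by
  obtain ⟨i, hi⟩ := Function.ne_iff.mp hU
  simp only [Pi.zero_apply] at hi
  have hentry : ∀ a b, U a * star (V b) - V a * star (U b) = lam * (if a = b then 1 else 0) := by
    intro a b
    simpa [Matrix.vecMulVec_apply, Matrix.one_apply] using congrFun (congrFun h a) b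
  have : Nontrivial (Fin n) := Fin.nontrivial_iff_two_le.mpr hn
  obtain ⟨j, hji⟩ := exists_ne i
  -- Evaluate the quadratic form at a nonzero vector orthogonal to `U`.
  have hlam : lam = 0 := by
    have hii := hentry i i
    have hij := hentry i j
    have hj := hentry j i
    have hjj := hentry j j
    simp only [hji, hji.symm, if_true, if_false, mul_one, mul_zero] at hii hij hj hjj
    have hmul : lam * (U i * star (U i) + U j * star (U j)) = 0 := by
      linear_combination -(U j * star (U j)) * hii + U j * star (U i) * hij
        + U i * star (U j) * hj - U i * star (U i) * hjj
    refine (mul_eq_zero.mp hmul).resolve_right fun h0 => ?_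
    have hre : Complex.normSq (U i) + Complex.normSq (U j) = 0 := by
      simp only [Complex.star_def, Complex.mul_conj] at h0
      exact_mod_cast h0
    have := Complex.normSq_pos.mpr hi
    have := Complex.normSq_nonneg (U j)
    linarith
  have hsi : star (U i) ≠ 0 := star_ne_zero.mpr hi
  refine ⟨star (V i) / star (U i), funext fun a => ?_⟩
  have ha := hentry a i
  rw [hlam, zero_mul] at ha
  rw [Pi.smul_apply, smul_eq_mul, div_mul_eq_mul_div, eq_div_iff hsi]
  linear_combination -ha
end

section
/- Let a, b, c, d, λ ∈ ℂ satisfy the four equations a·conj(c) − c·conj(a) = λ, a·conj(d) − c·conj(b) = 0, b·conj(c) − d·conj(a) = 0, and b·conj(d) − d·conj(b) = λ. Then λ = 0. -/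
/-- The explicit `2 × 2` case: if `a, b, c, d, λ ∈ ℂ` satisfy
`a·conj c − c·conj a = λ`, `a·conj d − c·conj b = 0`, `b·conj c − d·conj a = 0`,
and `b·conj d − d·conj b = λ`, then `λ = 0`. -/
theorem lambda_eq_zero_two_by_two (a b c d lam : ℂ)
    (h11 : a * (starRingEnd ℂ) c - c * (starRingEnd ℂ) a = lam)
    (h12 : a * (starRingEnd ℂ) d - c * (starRingEnd ℂ) b = 0)
    (h21 : b * (starRingEnd ℂ) c - d * (starRingEnd ℂ) a = 0)
    (h22 : b * (starRingEnd ℂ) d - d * (starRingEnd ℂ) b = lam) :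
    lam = 0 := by
  have det_eq : lam * lam = (Complex.normSq (a * d - b * c) : ℂ) := by
    rw [← Complex.mul_conj]
    simp only [map_sub, map_mul]
    linear_combination (-lam) * h11 -
      (a * (starRingEnd ℂ) c - c * (starRingEnd ℂ) a) * h22 +
      (b * (starRingEnd ℂ) c - d * (starRingEnd ℂ) a) * h12
  have re_eq : lam.re = 0 := by
    rw [← h11]
    simp only [Complex.sub_re, Complex.mul_re, Complex.conj_re, Complex.conj_im]
    ring
  have sq_eq := congrArg Complex.re det_eq
  rw [Complex.mul_re, re_eq, Complex.ofReal_re] at sq_eq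
  have im_eq : lam.im = 0 := by
    nlinarith [Complex.normSq_nonneg (a * d - b * c), sq_nonneg lam.im]
  exact Complex.ext re_eq im_eq
end

section
/- Let n ≥ 1 and let G : ℂⁿ × ℝ → ℂ be a smooth function satisfying Z̄_α G = 0 for all 1 ≤ α ≤ n (G is CR on ℍⁿ) and Z_β(Z_α G) = 0 for all 1 ≤ α, β ≤ n. Then there exist κ, λ ∈ ℂ and μ ∈ ℂⁿ such that G(z,t) = κ·(t + i|z|²) + z·μ + λ for all (z,t) ∈ ℂⁿ × ℝ. -/
/-- The Wirtinger derivative `∂F/∂z^α = ½(∂F/∂x^α − i ∂F/∂y^α)` of a function on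
the Heisenberg group `ℍⁿ = ℂⁿ × ℝ`. -/
noncomputable def pdz {n : ℕ} (α : Fin n) (F : (Fin n → ℂ) × ℝ → ℂ)
    (p : (Fin n → ℂ) × ℝ) : ℂ :=
  (1 / 2) * (fderiv ℝ F p (Pi.single α 1, 0) -
    Complex.I * fderiv ℝ F p (Pi.single α Complex.I, 0))

/-- The Wirtinger derivative `∂F/∂z̄^α = ½(∂F/∂x^α + i ∂F/∂y^α)`. -/
noncomputable def pdzbar {n : ℕ} (α : Fin n) (F : (Fin n → ℂ) × ℝ → ℂ)
    (p : (Fin n → ℂ) × ℝ) : ℂ :=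
  (1 / 2) * (fderiv ℝ F p (Pi.single α 1, 0) +
    Complex.I * fderiv ℝ F p (Pi.single α Complex.I, 0))

/-- The derivative `∂F/∂t` on `ℍⁿ = ℂⁿ × ℝ`. -/
noncomputable def pdt {n : ℕ} (F : (Fin n → ℂ) × ℝ → ℂ) (p : (Fin n → ℂ) × ℝ) : ℂ :=
  fderiv ℝ F p (0, 1)

/-- The left-invariant Heisenberg vector field `Z_α F = ∂F/∂z^α + i z̄^α ∂F/∂t`. -/
noncomputable def Zh {n : ℕ} (α : Fin n) (F : (Fin n → ℂ) × ℝ → ℂ)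
    (p : (Fin n → ℂ) × ℝ) : ℂ :=
  pdz α F p + Complex.I * (starRingEnd ℂ) (p.1 α) * pdt F p

/-- The conjugate Heisenberg vector field `Z̄_α F = ∂F/∂z̄^α − i z^α ∂F/∂t`. -/
noncomputable def Zhbar {n : ℕ} (α : Fin n) (F : (Fin n → ℂ) × ℝ → ℂ)
    (p : (Fin n → ℂ) × ℝ) : ℂ :=
  pdzbar α F p - Complex.I * (p.1 α) * pdt F p

open scoped ContDiff

/-- The coordinate `z^α` as a real-linear functional on `ℂⁿ × ℝ`. -/
noncomputable def coordCLM {n : ℕ} (α : Fin n) : ((Fin n → ℂ) × ℝ) →L[ℝ] ℂ :=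
  (ContinuousLinearMap.proj (R := ℝ) (φ := fun _ : Fin n => ℂ) α).comp
    (ContinuousLinearMap.fst ℝ (Fin n → ℂ) ℝ)

/-- The conjugate coordinate `z̄^α` as a real-linear functional on `ℂⁿ × ℝ`. -/
noncomputable def conjCoordCLM {n : ℕ} (α : Fin n) : ((Fin n → ℂ) × ℝ) →L[ℝ] ℂ :=
  Complex.conjCLE.toContinuousLinearMap.comp (coordCLM α)

/-- The coordinate `t` as a complex-valued real-linear functional on `ℂⁿ × ℝ`. -/
noncomputable def timeCLM {n : ℕ} : ((Fin n → ℂ) × ℝ) →L[ℝ] ℂ :=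
  Complex.ofRealCLM.comp (ContinuousLinearMap.snd ℝ (Fin n → ℂ) ℝ)

@[simp]
theorem coordCLM_apply {n : ℕ} (α : Fin n) (p : (Fin n → ℂ) × ℝ) : coordCLM α p = p.1 α := rfl

@[simp]
theorem conjCoordCLM_apply {n : ℕ} (α : Fin n) (p : (Fin n → ℂ) × ℝ) :
    conjCoordCLM α p = (starRingEnd ℂ) (p.1 α) := rfl

@[simp]
theorem timeCLM_apply {n : ℕ} (p : (Fin n → ℂ) × ℝ) : timeCLM p = (p.2 : ℂ) := rfl

section Smoothness

variable {n : ℕ} {F : (Fin n → ℂ) × ℝ → ℂ}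

theorem ContDiff.fderiv_apply_const (hF : ContDiff ℝ ∞ F) (v : (Fin n → ℂ) × ℝ) :
    ContDiff ℝ ∞ (fun q => fderiv ℝ F q v) :=
  (hF.fderiv_right (m := ∞) (by simp)).clm_apply contDiff_const

theorem ContDiff.pdt (hF : ContDiff ℝ ∞ F) : ContDiff ℝ ∞ (pdt F) :=
  hF.fderiv_apply_const _

theorem ContDiff.Zh (hF : ContDiff ℝ ∞ F) (α : Fin n) : ContDiff ℝ ∞ (Zh α F) :=
  (contDiff_const.mul ((hF.fderiv_apply_const _).sub
    (contDiff_const.mul (hF.fderiv_apply_const _)))).add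
    ((contDiff_const.mul (conjCoordCLM α).contDiff).mul (hF.fderiv_apply_const _))

theorem fderiv_fderiv_apply (hF : ContDiff ℝ ∞ F) (p v w : (Fin n → ℂ) × ℝ) :
    fderiv ℝ (fun q => fderiv ℝ F q w) p v = fderiv ℝ (fderiv ℝ F) p v w := by
  have h : DifferentiableAt ℝ (fderiv ℝ F) p :=
    (hF.fderiv_right (m := ∞) (by simp)).differentiable (by simp) p
  rw [fderiv_clm_apply h (differentiableAt_const w)]
  simp

theorem fderiv_fderiv_symm (hF : ContDiff ℝ ∞ F) (p v w : (Fin n → ℂ) × ℝ) :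
    fderiv ℝ (fderiv ℝ F) p v w = fderiv ℝ (fderiv ℝ F) p w v :=
  (hF.contDiffAt.isSymmSndFDerivAt (by
    simpa using WithTop.coe_le_coe.2 (le_top : (2 : ℕ∞) ≤ ⊤))).eq v w

theorem fderiv_Zh (hF : ContDiff ℝ ∞ F) (α : Fin n) (p v : (Fin n → ℂ) × ℝ) :
    fderiv ℝ (Zh α F) p v =
      (1 / 2) * (fderiv ℝ (fderiv ℝ F) p v (Pi.single α 1, 0) -
        Complex.I * fderiv ℝ (fderiv ℝ F) p v (Pi.single α Complex.I, 0)) +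
      Complex.I * ((starRingEnd ℂ) (p.1 α) * fderiv ℝ (fderiv ℝ F) p v (0, 1) +
        (starRingEnd ℂ) (v.1 α) * pdt F p) := by
  have hD (w) := ((hF.fderiv_apply_const w).differentiable (by simp) p).hasFDerivAt
  have h := (((hD (Pi.single α 1, 0)).sub
    ((hD (Pi.single α Complex.I, 0)).const_mul Complex.I)).const_mul (1 / 2)).add
    ((((conjCoordCLM α).hasFDerivAt (x := p)).const_mul Complex.I).mul (hD (0, 1)))
  have h' : HasFDerivAt (Zh α F) _ p := h
  rw [h'.fderiv]
  simp [fderiv_fderiv_apply hF, pdt]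
  ring

theorem fderiv_Zhbar (hF : ContDiff ℝ ∞ F) (α : Fin n) (p v : (Fin n → ℂ) × ℝ) :
    fderiv ℝ (Zhbar α F) p v =
      (1 / 2) * (fderiv ℝ (fderiv ℝ F) p v (Pi.single α 1, 0) +
        Complex.I * fderiv ℝ (fderiv ℝ F) p v (Pi.single α Complex.I, 0)) -
      Complex.I * (p.1 α * fderiv ℝ (fderiv ℝ F) p v (0, 1) + v.1 α * pdt F p) := by
  have hD (w) := ((hF.fderiv_apply_const w).differentiable (by simp) p).hasFDerivAt
  have h := (((hD (Pi.single α 1, 0)).add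
    ((hD (Pi.single α Complex.I, 0)).const_mul Complex.I)).const_mul (1 / 2)).sub
    ((((coordCLM α).hasFDerivAt (x := p)).const_mul Complex.I).mul (hD (0, 1)))
  have h' : HasFDerivAt (Zhbar α F) _ p := h
  rw [h'.fderiv]
  simp [fderiv_fderiv_apply hF, pdt]
  ring

end Smoothness

section Commutators

variable {n : ℕ} {F : (Fin n → ℂ) × ℝ → ℂ}

theorem pdt_Zh (hF : ContDiff ℝ ∞ F) (α : Fin n) (p : (Fin n → ℂ) × ℝ) :
    pdt (Zh α F) p = Zh α (pdt F) p := by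
  have h (v) : fderiv ℝ (pdt F) p v = fderiv ℝ (fderiv ℝ F) p (0, 1) v :=
    (fderiv_fderiv_apply hF p v (0, 1)).trans (fderiv_fderiv_symm hF p v (0, 1))
  rw [pdt, fderiv_Zh hF, Zh, pdz, pdt, h, h, pdt, h]
  simp
  ring

theorem pdt_Zhbar (hF : ContDiff ℝ ∞ F) (α : Fin n) (p : (Fin n → ℂ) × ℝ) :
    pdt (Zhbar α F) p = Zhbar α (pdt F) p := by
  have h (v) : fderiv ℝ (pdt F) p v = fderiv ℝ (fderiv ℝ F) p (0, 1) v :=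
    (fderiv_fderiv_apply hF p v (0, 1)).trans (fderiv_fderiv_symm hF p v (0, 1))
  rw [pdt, fderiv_Zhbar hF, Zhbar, pdzbar, pdt, h, h, pdt, h]
  simp
  ring

/-- The commutation relation `[Z̄_γ, Z_α] = 2i δ_{γα} ∂/∂t`. -/
theorem Zhbar_Zh (hF : ContDiff ℝ ∞ F) (γ α : Fin n) (p : (Fin n → ℂ) × ℝ) :
    Zhbar γ (Zh α F) p =
      Zh α (Zhbar γ F) p + (if γ = α then 2 * Complex.I * pdt F p else 0) := by
  have hs := fderiv_fderiv_symm hF p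
  rw [Zhbar, pdzbar, Zh, pdz, pdt, pdt]
  simp only [fderiv_Zhbar hF, fderiv_Zh hF]
  rw [hs (Pi.single α 1, 0) (Pi.single γ 1, 0), hs (Pi.single α 1, 0) (Pi.single γ Complex.I, 0),
    hs (Pi.single α Complex.I, 0) (Pi.single γ 1, 0),
    hs (Pi.single α Complex.I, 0) (Pi.single γ Complex.I, 0),
    hs (0, 1) (Pi.single γ 1, 0), hs (0, 1) (Pi.single γ Complex.I, 0),
    hs (Pi.single α 1, 0) (0, 1), hs (Pi.single α Complex.I, 0) (0, 1),
    hs (Pi.single γ 1, 0) (0, 1), hs (Pi.single γ Complex.I, 0) (0, 1)]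
  by_cases h : γ = α
  · subst h
    simp
    ring_nf
    simp
    ring
  · simp [h, Ne.symm h]
    ring

end Commutators

section Linearity

variable {n : ℕ} {F E : (Fin n → ℂ) × ℝ → ℂ} {p : (Fin n → ℂ) × ℝ}

theorem Zh_sub (hF : DifferentiableAt ℝ F p) (hE : DifferentiableAt ℝ E p) (α : Fin n) :
    Zh α (F - E) p = Zh α F p - Zh α E p := by
  simp only [Zh, pdz, pdt, fderiv_sub hF hE, sub_apply]
  ring

theorem Zhbar_sub (hF : DifferentiableAt ℝ F p) (hE : DifferentiableAt ℝ E p) (α : Fin n) :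
    Zhbar α (F - E) p = Zhbar α F p - Zhbar α E p := by
  simp only [Zhbar, pdzbar, pdt, fderiv_sub hF hE, sub_apply]
  ring

theorem pdt_sub (hF : DifferentiableAt ℝ F p) (hE : DifferentiableAt ℝ E p) :
    pdt (F - E) p = pdt F p - pdt E p := by
  simp only [pdt, fderiv_sub hF hE, sub_apply]

end Linearity

theorem ContinuousLinearMap.eq_zero_of_heisenberg_basis {n : ℕ} {L : ((Fin n → ℂ) × ℝ) →L[ℝ] ℂ}
    (h1 : ∀ α, L (Pi.single α 1, 0) = 0) (hI : ∀ α, L (Pi.single α Complex.I, 0) = 0)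
    (ht : L (0, 1) = 0) : L = 0 := by
  refine ContinuousLinearMap.ext fun v => ?_
  have hv : v = ∑ α, ((v.1 α).re • ((Pi.single α 1, 0) : (Fin n → ℂ) × ℝ) +
      (v.1 α).im • ((Pi.single α Complex.I, 0) : (Fin n → ℂ) × ℝ)) + v.2 • (0, 1) := by
    refine Prod.ext ?_ ?_
    · funext β
      simp [Prod.fst_sum, Finset.sum_apply, Pi.single_apply, Finset.sum_add_distrib]
    · simp [Prod.snd_sum]
  rw [hv]
  simp only [map_add, map_sum, map_smul, h1, hI, ht]
  simp

/-- A function annihilated by all the fields `Z_α`, `Z̄_α` and `∂/∂t` is constant. -/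
theorem eq_const_of_heisenberg_fields_eq_zero {n : ℕ} {F : (Fin n → ℂ) × ℝ → ℂ}
    (hF : Differentiable ℝ F) (hZ : ∀ α p, Zh α F p = 0) (hZbar : ∀ α p, Zhbar α F p = 0)
    (hT : ∀ p, pdt F p = 0) (p : (Fin n → ℂ) × ℝ) : F p = F 0 := by
  refine is_const_of_fderiv_eq_zero (𝕜 := ℝ) hF (fun q => ?_) p 0
  have hz (α) : pdz α F q = 0 := by simpa [Zh, hT] using hZ α q
  have hzbar (α) : pdzbar α F q = 0 := by simpa [Zhbar, hT] using hZbar α q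
  simp only [pdz, pdzbar] at hz hzbar
  refine ContinuousLinearMap.eq_zero_of_heisenberg_basis (fun α => ?_) (fun α => ?_) (hT q)
  · linear_combination hz α + hzbar α
  · linear_combination Complex.I * hz α - Complex.I * hzbar α +
      fderiv ℝ F q (Pi.single α Complex.I, 0) * Complex.I_mul_I

/-- The CR function `κ·(t + i|z|²) + z·μ`. -/
noncomputable def affineCR {n : ℕ} (κ : ℂ) (μ : Fin n → ℂ) (p : (Fin n → ℂ) × ℝ) : ℂ :=
  κ * (p.2 + Complex.I * ∑ α, p.1 α * (starRingEnd ℂ) (p.1 α)) + ∑ α, p.1 α * μ α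

section AffineCR

variable {n : ℕ} (κ : ℂ) (μ : Fin n → ℂ) (p : (Fin n → ℂ) × ℝ)

theorem hasFDerivAt_affineCR :
    HasFDerivAt (affineCR κ μ)
      (κ • (timeCLM + Complex.I • ∑ α, (p.1 α • conjCoordCLM α +
        (starRingEnd ℂ) (p.1 α) • coordCLM α)) + ∑ α, μ α • coordCLM α) p := by
  have hz (α : Fin n) := (coordCLM α).hasFDerivAt (x := p)
  have hzbar (α : Fin n) := (conjCoordCLM α).hasFDerivAt (x := p)
  exact (((timeCLM.hasFDerivAt (x := p)).add ((HasFDerivAt.fun_sum fun α _ =>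
    (hz α).mul (hzbar α)).const_mul Complex.I)).const_mul κ).add
    (HasFDerivAt.fun_sum fun α _ => (hz α).mul_const (μ α))

theorem pdt_affineCR : pdt (affineCR κ μ) p = κ := by
  simp [pdt, (hasFDerivAt_affineCR κ μ p).fderiv]

theorem Zh_affineCR (α : Fin n) :
    Zh α (affineCR κ μ) p = 2 * Complex.I * κ * (starRingEnd ℂ) (p.1 α) + μ α := by
  simp only [Zh, pdt_affineCR, pdz, (hasFDerivAt_affineCR κ μ p).fderiv]
  simp [Pi.single_apply, Finset.sum_add_distrib, apply_ite]
  ring_nf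
  simp
  ring

theorem Zhbar_affineCR (α : Fin n) : Zhbar α (affineCR κ μ) p = 0 := by
  simp only [Zhbar, pdt_affineCR, pdzbar, (hasFDerivAt_affineCR κ μ p).fderiv]
  simp [Pi.single_apply, Finset.sum_add_distrib, apply_ite]
  ring_nf
  simp

end AffineCR

section ConjCoord

variable {n : ℕ} (c : ℂ) (α β : Fin n) (p : (Fin n → ℂ) × ℝ)

theorem Zh_conjCoord : Zh β ⇑(c • conjCoordCLM α) p = 0 := by
  have h := ((c • conjCoordCLM α).hasFDerivAt (x := p)).fderiv
  by_cases hab : α = β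
  · subst hab
    simp only [Zh, pdz, pdt, h]
    simp
    ring_nf
    simp
  · simp only [Zh, pdz, pdt, h]
    simp [hab]

theorem Zhbar_conjCoord : Zhbar β ⇑(c • conjCoordCLM α) p = if β = α then c else 0 := by
  have h := ((c • conjCoordCLM α).hasFDerivAt (x := p)).fderiv
  by_cases hab : α = β
  · subst hab
    simp only [Zhbar, pdzbar, pdt, h]
    simp
    ring_nf
    simp
    ring
  · simp only [Zhbar, pdzbar, pdt, h]
    simp [hab, Ne.symm hab]

theorem pdt_conjCoord : pdt ⇑(c • conjCoordCLM α) p = 0 := by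
  rw [pdt, ((c • conjCoordCLM α).hasFDerivAt (x := p)).fderiv]
  simp

end ConjCoord

/-- If `G : ℂⁿ × ℝ → ℂ` is smooth, CR on `ℍⁿ` (`Z̄_α G = 0`) and
satisfies `Z_β Z_α G = 0` for all `α, β`, then
`G(z,t) = κ·(t + i|z|²) + z·μ + λ` for some constants `κ, λ ∈ ℂ`, `μ ∈ ℂⁿ`. -/
theorem cr_second_order_kernel (n : ℕ) (hn : 1 ≤ n) (G : (Fin n → ℂ) × ℝ → ℂ)
    (hG : ContDiff ℝ (⊤ : ℕ∞) G)
    (hCR : ∀ (α : Fin n) (p : (Fin n → ℂ) × ℝ), Zhbar α G p = 0)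
    (h2 : ∀ (α β : Fin n) (p : (Fin n → ℂ) × ℝ), Zh β (fun q => Zh α G q) p = 0) :
    ∃ κ lam : ℂ, ∃ μ : Fin n → ℂ, ∀ p : (Fin n → ℂ) × ℝ,
      G p = κ * (↑p.2 + Complex.I * ↑(∑ α, Complex.normSq (p.1 α)))
        + (∑ α, p.1 α * μ α) + lam := by
  have hK (α : Fin n) : ContDiff ℝ ∞ (Zh α G) := hG.Zh α
  have hg : ContDiff ℝ ∞ (pdt G) := hG.pdt
  have hCR' (γ : Fin n) : Zhbar γ G = 0 := funext (hCR γ)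
  have h2' (α β : Fin n) : Zh β (Zh α G) = 0 := funext (h2 α β)
  have hZ0 (β : Fin n) (p) : Zh β (0 : (Fin n → ℂ) × ℝ → ℂ) p = 0 := by simp [Zh, pdz, pdt]
  have hZbar0 (β : Fin n) (p) : Zhbar β (0 : (Fin n → ℂ) × ℝ → ℂ) p = 0 := by
    simp [Zhbar, pdzbar, pdt]
  have hZbarK (γ α : Fin n) (p) :
      Zhbar γ (Zh α G) p = if γ = α then 2 * Complex.I * pdt G p else 0 := by
    rw [Zhbar_Zh hG, hCR', hZ0, zero_add]
  have hZbarg (γ : Fin n) (p) : Zhbar γ (pdt G) p = 0 := by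
    rw [← pdt_Zhbar hG, hCR']
    simp [pdt]
  have hZg (α : Fin n) (p) : Zh α (pdt G) p = 0 := by
    have h := Zhbar_Zh (hK α) α α p
    have hfun : Zhbar α (Zh α G) = fun q => 2 * Complex.I * pdt G q :=
      funext fun q => by simp [hZbarK]
    have hmul : Zh α (fun q => 2 * Complex.I * pdt G q) p =
        2 * Complex.I * Zh α (pdt G) p := by
      have hd := fderiv_const_mul (hg.differentiable (by simp) p) (2 * Complex.I)
      rw [Zh, pdz, pdt, hd]
      simp [Zh, pdz, pdt]
      ring
    rw [h2', hZbar0, hfun, hmul, if_pos rfl, pdt_Zh hG] at h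
    linear_combination (Complex.I / 4) * h + Zh α (pdt G) p * Complex.I_mul_I
  have hTg (p) : pdt (pdt G) p = 0 := by
    have h := Zhbar_Zh hg ⟨0, hn⟩ ⟨0, hn⟩ p
    rw [funext (hZg _), funext (hZbarg _)] at h
    have h0 := (hZbar0 ⟨0, hn⟩ p).symm.trans h
    have h1 := hZ0 ⟨0, hn⟩ p
    simp only [Pi.zero_def] at h1
    rw [h1] at h0
    simpa using h0
  set κ := pdt G 0
  have hκ (p) : pdt G p = κ :=
    eq_const_of_heisenberg_fields_eq_zero (hg.differentiable (by simp)) hZg hZbarg hTg p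
  have hμ (α : Fin n) (p) : Zh α G p - 2 * Complex.I * κ * (starRingEnd ℂ) (p.1 α) =
      Zh α G 0 := by
    have hdK := (hK α).differentiable (by simp)
    have hdE : Differentiable ℝ ⇑((2 * Complex.I * κ) • conjCoordCLM α) :=
      ContinuousLinearMap.differentiable _
    have h := eq_const_of_heisenberg_fields_eq_zero
      (F := Zh α G - ⇑((2 * Complex.I * κ) • conjCoordCLM α)) (hdK.sub hdE)
      (fun β q => by
        have := Zh_conjCoord (2 * Complex.I * κ) α β q
        rw [Zh_sub (hdK q) (hdE q), h2']
        simpa using this)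
      (fun β q => by
        have := Zhbar_conjCoord (2 * Complex.I * κ) α β q
        rw [Zhbar_sub (hdK q) (hdE q), hZbarK, hκ]
        exact sub_eq_zero.2 this.symm)
      (fun q => by
        have := pdt_conjCoord (2 * Complex.I * κ) α q
        rw [pdt_sub (hdK q) (hdE q), pdt_Zh hG, hZg]
        simpa using this) p
    simpa using h
  have hdG := hG.differentiable (by simp)
  have hdA (q) := (hasFDerivAt_affineCR κ (fun α => Zh α G 0) q).differentiableAt
  refine ⟨κ, G 0, fun α => Zh α G 0, fun p => ?_⟩
  have h := eq_const_of_heisenberg_fields_eq_zero (F := G - affineCR κ (fun α => Zh α G 0))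
    (hdG.sub hdA)
    (fun α q => by
      rw [Zh_sub (hdG q) (hdA q), Zh_affineCR]
      linear_combination hμ α q)
    (fun α q => by rw [Zhbar_sub (hdG q) (hdA q), Zhbar_affineCR, hCR, sub_zero])
    (fun q => by rw [pdt_sub (hdG q) (hdA q), pdt_affineCR, hκ, sub_self]) p
  simp only [Pi.sub_apply, affineCR, Complex.mul_conj] at h
  simp only [Complex.ofReal_sum]
  simp at h
  linear_combination h
end

section
/- Let n ≥ 1. For every point (z₀,t₀) ∈ ℂⁿ × ℝ and every w ∈ ℂⁿ, there exist κ, λ ∈ ℂ and μ ∈ ℂⁿ such that the function G(z,t) = κ·(t + i|z|²) + z·μ + λ satisfies G(z₀,t₀) ≠ 0 and −(Z_α G)(z₀,t₀)/(2·G(z₀,t₀)) = w_α for every 1 ≤ α ≤ n. Equivalently, the CR-pluriharmonic solutions φ = −log|G| of the Möbius equation on (ℍⁿ, Θ) can be chosen with arbitrarily prescribed horizontal gradient ((Z_1 φ)(z₀,t₀), …, (Z_n φ)(z₀,t₀)) = w at any given point, i.e. the Möbius equation is fully integrable on the Heisenberg group. -/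
/-- `Z_α` of the affine function `(z,t) ↦ z·μ + c`, which is holomorphic in `z` and independent
of `t`, is the constant `μ_α`. -/
theorem Zh_affine {n : ℕ} (α : Fin n) (μ : Fin n → ℂ) (c : ℂ) (p : (Fin n → ℂ) × ℝ) :
    Zh α (fun q : (Fin n → ℂ) × ℝ => (∑ β, q.1 β * μ β) + c) p = μ α := by
  have hG : HasFDerivAt (fun q : (Fin n → ℂ) × ℝ => (∑ β, q.1 β * μ β) + c)
      (∑ β, μ β • ((ContinuousLinearMap.proj (R := ℝ) (φ := fun _ : Fin n => ℂ) β).comp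
        (ContinuousLinearMap.fst ℝ (Fin n → ℂ) ℝ))) p := by
    refine HasFDerivAt.add_const c (HasFDerivAt.fun_sum fun β _ => ?_)
    exact ((ContinuousLinearMap.proj (R := ℝ) (φ := fun _ : Fin n => ℂ) β).comp
      (ContinuousLinearMap.fst ℝ (Fin n → ℂ) ℝ)).hasFDerivAt.mul_const (μ β)
  simp only [Zh, pdz, pdt, hG.fderiv]
  simp [Pi.single_apply]
  linear_combination (-μ α / 2) * Complex.I_sq

/-- Full integrability of the Möbius equation on the Heisenberg
group: for every point `(z₀,t₀) ∈ ℂⁿ × ℝ` and every `w ∈ ℂⁿ`, there are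
`κ, λ ∈ ℂ`, `μ ∈ ℂⁿ` such that `G(z,t) = κ(t + i|z|²) + z·μ + λ` satisfies
`G(z₀,t₀) ≠ 0` and `−(Z_α G)(z₀,t₀)/(2 G(z₀,t₀)) = w_α` for each `α`; i.e. the
CR-pluriharmonic solutions `φ = −log|G|` can be chosen with arbitrarily
prescribed horizontal gradient `Z_α φ = w_α` at the given point. -/
theorem mobius_fully_integrable_heisenberg (n : ℕ) (hn : 1 ≤ n)
    (p₀ : (Fin n → ℂ) × ℝ) (w : Fin n → ℂ) :
    ∃ κ lam : ℂ, ∃ μ : Fin n → ℂ, ∃ G : (Fin n → ℂ) × ℝ → ℂ,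
      (∀ p : (Fin n → ℂ) × ℝ,
        G p = κ * (↑p.2 + Complex.I * ↑(∑ α, Complex.normSq (p.1 α)))
          + (∑ α, p.1 α * μ α) + lam) ∧
      G p₀ ≠ 0 ∧
      ∀ α : Fin n, -(Zh α G p₀) / (2 * G p₀) = w α := by
  refine ⟨0, 1 - ∑ α, p₀.1 α * (-2 * w α), fun α => -2 * w α,
    fun q => (∑ α, q.1 α * (-2 * w α)) + (1 - ∑ α, p₀.1 α * (-2 * w α)),
    fun p => by ring, by simp, fun α => ?_⟩
  rw [Zh_affine α (fun β => -2 * w β)]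
  simp
end
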